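/- arXiv:1403.1722 — 9 statements merged into one kernel-verified Lean document; each statement's English description precedes it below -/
import Mathlib

section
/- Let 𝒜 = (Q,A,δ,λ) be an invertible transducer and G = G(𝒜). The following are equivalent: (i) G is finite; (ii) the semigroup of self-maps of Q* generated by the section maps w ↦ w⟨a⟩ (a ∈ A) is finite; (iii) there is an integer n such that every orbit of G on the boundary A^ω has at most n elements. -/
namespace Paper

variable {Q A T : Type*}

/-- Output action of a single state on a finite word. -/
def tOut (δ : Q → A → Q) (lam : Q → A → A) : Q → List A → List A
  | _, [] => []
  | q, a :: w => lam q a :: tOut δ lam (δ q a) w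

/-- Output action of a word of states (leftmost letter acts first). -/
def wOut (δ : Q → A → Q) (lam : Q → A → A) (u : List Q) (w : List A) : List A :=
  u.foldl (fun v q => tOut δ lam q v) w

/-- Section (dual action) of a word of states by a single letter. -/
def sec (δ : Q → A → Q) (lam : Q → A → A) : List Q → A → List Q
  | [], _ => []
  | q :: u, a => δ q a :: sec δ lam u (lam q a)

/-- Section of a word of states by a word of letters. -/
def secW (δ : Q → A → Q) (lam : Q → A → A) (u : List Q) (v : List A) : List Q :=
  v.foldl (sec δ lam) u

/-- Single step of the enriched alphabet `Q ⊕ Q` (second copy = formal inverses). -/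
noncomputable def stepT [Nonempty A] (δ : Q → A → Q) (lam : Q → A → A) :
    Q ⊕ Q → A → (Q ⊕ Q) × A
  | Sum.inl q, a => (Sum.inl (δ q a), lam q a)
  | Sum.inr q, a => (Sum.inr (δ q (Function.invFun (lam q) a)), Function.invFun (lam q) a)

noncomputable def tOutT [Nonempty A] (δ : Q → A → Q) (lam : Q → A → A) :
    Q ⊕ Q → List A → List A
  | _, [] => []
  | x, a :: w => (stepT δ lam x a).2 :: tOutT δ lam (stepT δ lam x a).1 w

noncomputable def wOutT [Nonempty A] (δ : Q → A → Q) (lam : Q → A → A)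
    (u : List (Q ⊕ Q)) (w : List A) : List A :=
  u.foldl (fun v x => tOutT δ lam x v) w

noncomputable def secT [Nonempty A] (δ : Q → A → Q) (lam : Q → A → A) :
    List (Q ⊕ Q) → A → List (Q ⊕ Q)
  | [], _ => []
  | x :: u, a => (stepT δ lam x a).1 :: secT δ lam u ((stepT δ lam x a).2)

noncomputable def secTW [Nonempty A] (δ : Q → A → Q) (lam : Q → A → A)
    (u : List (Q ⊕ Q)) (v : List A) : List (Q ⊕ Q) :=
  v.foldl (secT δ lam) u

/-- The automaton group as subgroup of the permutations of `A*`. -/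
def autGroup (δ : Q → A → Q) (lam : Q → A → A) : Subgroup (Equiv.Perm (List A)) :=
  Subgroup.closure {g : Equiv.Perm (List A) | ∃ q : Q, ∀ w, g w = tOut δ lam q w}

/-- Induced action of a length- and prefix-preserving map on the boundary. -/
def boundaryAct (g : List A → List A) (v : ℕ → A) : ℕ → A :=
  fun i => (g ((List.range (i + 1)).map v)).getD i (v i)

/-- The periodic sequence `w^ω`. -/
noncomputable def perSeq [Nonempty A] (w : List A) : ℕ → A :=
  fun i => w.getD (i % w.length) (Classical.arbitrary A)

/-- `u^n`: `n`-fold concatenation of a word with itself. -/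
def rep (u : List A) (n : ℕ) : List A := (List.replicate n u).flatten

def Reversible (δ : Q → A → Q) : Prop := ∀ a, Function.Bijective (fun q => δ q a)

def Invertible' (lam : Q → A → A) : Prop := ∀ q, Function.Bijective (lam q)

def Bireversible (δ : Q → A → Q) (lam : Q → A → A) : Prop :=
  Invertible' lam ∧ Reversible δ ∧
    ∀ q q' a a', lam q a = lam q' a' → δ q a = δ q' a' → (q, a) = (q', a')

def prodδ (δ₁ : Q → A → Q) (lam₁ : Q → A → A) (δ₂ : T → A → T) :
    Q × T → A → Q × T :=
  fun p a => (δ₁ p.1 a, δ₂ p.2 (lam₁ p.1 a))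

def prodLam (lam₁ : Q → A → A) (lam₂ : T → A → A) : Q × T → A → A :=
  fun p a => lam₂ p.2 (lam₁ p.1 a)

end Paper

open Paper

namespace Paper

/-- A map that factors through a finite type has finite range. -/
theorem finite_range_of_factorsThrough {α β γ : Type*} [Nonempty γ] [Finite β]
    {h : α → γ} {f : α → β} (H : Function.FactorsThrough h f) : (Set.range h).Finite := by
  obtain ⟨e, rfl⟩ := (Function.factorsThrough_iff h).1 H
  rw [Set.range_comp]
  exact (Set.toFinite _).image e

/-- A finitely generated group has finitely many homomorphisms to a finite group. -/
theorem finite_monoidHom_of_fg {G H : Type*} [Group G] [Group.FG G] [Group H] [Finite H] :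
    Finite (G →* H) := by
  obtain ⟨S, hS⟩ := Group.fg_def.1 (inferInstance : Group.FG G)
  refine Finite.of_injective (β := S → H) (fun φ s => φ s) fun φ ψ h => ?_
  exact MonoidHom.eq_of_eqOn_dense hS fun s hs => congrFun h ⟨s, hs⟩

/-- A finitely generated group with a faithful action whose orbits have bounded size is finite. -/
theorem finite_of_ncard_orbit_le {G X : Type*} [Group G] [Group.FG G] [MulAction G X]
    [FaithfulSMul G X] (n : ℕ)
    (h : ∀ x : X, (MulAction.orbit G x).Finite ∧ (MulAction.orbit G x).ncard ≤ n) :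
    Finite G := by
  have : Finite (G →* Equiv.Perm (Fin n)) := finite_monoidHom_of_fg
  refine Finite.of_injective
    (fun (g : G) (φ : G →* Equiv.Perm (Fin n)) => φ g) fun g k hgk => ?_
  refine FaithfulSMul.eq_of_smul_eq_smul (α := X) fun x => ?_
  obtain ⟨hfin, hcard⟩ := h x
  have : Fintype (MulAction.orbit G x) := hfin.fintype
  obtain ⟨e⟩ : Nonempty (MulAction.orbit G x ↪ Fin n) := by
    rw [Function.Embedding.nonempty_iff_card_le, Fintype.card_fin, ← Nat.card_eq_fintype_card]
    exact hcard
  have hx := Equiv.Perm.viaEmbeddingHom_injective e (congrFun hgk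
    ((Equiv.Perm.viaEmbeddingHom e).comp (MulAction.toPermHom G (MulAction.orbit G x))))
  exact congrArg Subtype.val
    (congrArg (fun σ => σ (⟨x, MulAction.mem_orbit_self x⟩ : MulAction.orbit G x)) hx)

section Transducer

variable {Q A : Type*} {δ : Q → A → Q} {lam : Q → A → A}

theorem length_tOut (q : Q) (w : List A) : (tOut δ lam q w).length = w.length := by
  induction w generalizing q with
  | nil => rfl
  | cons a w ih => simp [tOut, ih]

theorem take_tOut (q : Q) (w : List A) (k : ℕ) :
    (tOut δ lam q w).take k = tOut δ lam q (w.take k) := by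
  induction w generalizing q k with
  | nil => simp [tOut]
  | cons a w ih => cases k <;> simp [tOut, ih]

theorem tOut_bijective (hinv : ∀ q, Function.Bijective (lam q)) (q : Q) :
    Function.Bijective (tOut δ lam q) := by
  constructor
  · intro w w' h
    induction w generalizing q w' with
    | nil => cases w' <;> simp_all [tOut]
    | cons a w ih =>
      cases w' with
      | nil => simp [tOut] at h
      | cons b w' =>
        simp only [tOut, List.cons.injEq] at h
        obtain rfl := (hinv q).1 h.1
        rw [ih _ h.2]
  · intro w
    induction w generalizing q with
    | nil => exact ⟨[], rfl⟩
    | cons a w ih =>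
      obtain ⟨b, rfl⟩ := (hinv q).2 a
      obtain ⟨v, rfl⟩ := ih (δ q b)
      exact ⟨b :: v, rfl⟩

/-- The permutation of `A*` induced by a state of an invertible transducer. -/
noncomputable def tPerm (δ : Q → A → Q) (lam : Q → A → A)
    (hinv : ∀ q, Function.Bijective (lam q)) (q : Q) : Equiv.Perm (List A) :=
  Equiv.ofBijective (tOut δ lam q) (tOut_bijective hinv q)

theorem autGroup_eq_closure_range (hinv : ∀ q, Function.Bijective (lam q)) :
    autGroup δ lam = Subgroup.closure (Set.range (tPerm δ lam hinv)) := by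
  unfold autGroup
  congr 1
  ext g
  exact exists_congr fun q => ⟨fun h => Equiv.ext fun w => (h w).symm, fun h w => by rw [← h]; rfl⟩

theorem tPerm_mem_autGroup (hinv : ∀ q, Function.Bijective (lam q)) (q : Q) :
    tPerm δ lam hinv q ∈ autGroup δ lam :=
  Subgroup.subset_closure ⟨q, fun _ => rfl⟩

theorem autGroup_fg [Finite Q] (hinv : ∀ q, Function.Bijective (lam q)) :
    Group.FG (autGroup δ lam) := by
  rw [autGroup_eq_closure_range hinv]
  exact Group.closure_finite_fg _

theorem autGroup_length_take {g : Equiv.Perm (List A)} (hg : g ∈ autGroup δ lam) :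
    ∀ w, (g w).length = w.length ∧ ∀ k, (g w).take k = g (w.take k) := by
  induction hg using Subgroup.closure_induction with
  | mem g hg =>
    obtain ⟨q, hq⟩ := hg
    intro w
    simp [hq, length_tOut, take_tOut]
  | one => simp
  | mul g h _ _ ihg ihh =>
    intro w
    simp [(ihg _).1, (ihg _).2, (ihh _).1, (ihh _).2]
  | inv g _ ih =>
    intro w
    refine ⟨?_, fun k => g.injective ?_⟩
    · simpa using (ih (g⁻¹ w)).1.symm
    · simpa using ((ih (g⁻¹ w)).2 k).symm

/-- The boundary action of a group element extends its action on prefixes. -/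
theorem map_range_boundaryAct {g : Equiv.Perm (List A)} (hg : g ∈ autGroup δ lam)
    (v : ℕ → A) (k : ℕ) :
    (List.range k).map (boundaryAct g v) = g ((List.range k).map v) := by
  have hlen (m : ℕ) : (g ((List.range m).map v)).length = m := by
    simp [(autGroup_length_take hg _).1]
  refine List.ext_getElem (by simp [hlen]) fun i hi hi' => ?_
  have hik : i + 1 ≤ k := by simpa using hi
  have htake : (g ((List.range k).map v)).take (i + 1) = g ((List.range (i + 1)).map v) := by
    rw [(autGroup_length_take hg _).2, ← List.map_take, List.take_range, min_eq_left hik]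
  simp [boundaryAct, ← htake, List.getElem?_eq_getElem hi']

theorem finite_autGroup_of_boundary_orbits [Finite Q] [Nonempty A]
    (hinv : ∀ q, Function.Bijective (lam q)) (n : ℕ)
    (h : ∀ v : ℕ → A,
      Set.Finite {x : ℕ → A | ∃ g ∈ autGroup δ lam, boundaryAct (⇑g) v = x} ∧
      Set.ncard {x : ℕ → A | ∃ g ∈ autGroup δ lam, boundaryAct (⇑g) v = x} ≤ n) :
    Finite (autGroup δ lam) := by
  have := autGroup_fg (δ := δ) hinv
  refine finite_of_ncard_orbit_le (X := List A) n fun w => ?_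
  let v : ℕ → A := fun i => w.getD i (Classical.arbitrary A)
  have hv : (List.range w.length).map v = w :=
    List.ext_getElem (by simp) fun i hi hi' => by simp [v, List.getElem?_eq_getElem hi']
  obtain ⟨hfin, hcard⟩ := h v
  have horb : MulAction.orbit (autGroup δ lam) w ⊆
      (fun x : ℕ → A => (List.range w.length).map x) ''
        {x : ℕ → A | ∃ g ∈ autGroup δ lam, boundaryAct (⇑g) v = x} := by
    rintro _ ⟨⟨g, hg⟩, rfl⟩
    refine ⟨_, ⟨g, hg, rfl⟩, ?_⟩
    simp only [map_range_boundaryAct hg, hv]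
    rfl
  exact ⟨(hfin.image _).subset horb,
    ((Set.ncard_le_ncard horb (hfin.image _)).trans (Set.ncard_image_le hfin)).trans hcard⟩

theorem secW_cons (q : Q) (u : List Q) (v : List A) :
    secW δ lam (q :: u) v = v.foldl δ q :: secW δ lam u (tOut δ lam q v) := by
  induction v generalizing q u with
  | nil => rfl
  | cons a v ih => exact ih _ _

theorem secW_eq_of_foldl_eq (hinv : ∀ q, Function.Bijective (lam q)) {v v' : List A}
    (h : ∀ g ∈ autGroup δ lam, ∀ q, (g v).foldl δ q = (g v').foldl δ q) (u : List Q) :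
    secW δ lam u v = secW δ lam u v' := by
  have secW_nil (w : List A) : secW δ lam [] w = [] := by
    induction w with
    | nil => rfl
    | cons a w ih => exact ih
  induction u generalizing v v' with
  | nil => rw [secW_nil, secW_nil]
  | cons q u ih =>
    rw [secW_cons, secW_cons]
    exact congrArg₂ List.cons (h 1 (one_mem _) q) (ih fun g hg =>
      h (g * tPerm δ lam hinv q) (mul_mem hg (tPerm_mem_autGroup hinv q)))

theorem finite_range_secW [Finite Q] (hinv : ∀ q, Function.Bijective (lam q))
    [Finite (autGroup δ lam)] :
    (Set.range fun (v : List A) (u : List Q) => secW δ lam u v).Finite :=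
  finite_range_of_factorsThrough
    (f := fun (v : List A) (g : autGroup δ lam) (q : Q) => (g.1 v).foldl δ q)
    fun _ _ h => funext <| secW_eq_of_foldl_eq hinv fun g hg q => congrFun (congrFun h ⟨g, hg⟩) q

theorem wOut_cons_letter (u : List Q) (a : A) (w : List A) :
    wOut δ lam u (a :: w) =
      u.foldl (fun b q => lam q b) a :: wOut δ lam (sec δ lam u a) w := by
  induction u generalizing a w with
  | nil => rfl
  | cons q u ih => exact ih _ _

theorem wOut_eq_of_letter_eq {u u' : List Q}
    (h : ∀ (v : List A) (a : A), (secW δ lam u v).foldl (fun b q => lam q b) a =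
      (secW δ lam u' v).foldl (fun b q => lam q b) a) (w : List A) :
    wOut δ lam u w = wOut δ lam u' w := by
  have wOut_nil (u : List Q) : wOut δ lam u [] = [] := by
    induction u with
    | nil => rfl
    | cons q u ih => exact ih
  induction w generalizing u u' with
  | nil => rw [wOut_nil, wOut_nil]
  | cons a w ih =>
    rw [wOut_cons_letter, wOut_cons_letter, ih fun v => h (a :: v)]
    exact congrArg (· :: _) (h [] a)

theorem finite_range_wOut [Finite A]
    (h : (Set.range fun (v : List A) (u : List Q) => secW δ lam u v).Finite) :
    (Set.range (wOut δ lam)).Finite := by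
  have := h.to_subtype
  exact finite_range_of_factorsThrough
    (f := fun (u : List Q) (s : Set.range fun (v : List A) (u : List Q) => secW δ lam u v)
      (a : A) => (s.1 u).foldl (fun b q => lam q b) a)
    fun _ _ h => funext <| wOut_eq_of_letter_eq fun v a => congrFun (congrFun h ⟨_, v, rfl⟩) a

theorem exists_wOut_of_mem_closure (hinv : ∀ q, Function.Bijective (lam q))
    {g : Equiv.Perm (List A)} (hg : g ∈ Submonoid.closure (Set.range (tPerm δ lam hinv))) :
    ∃ u, wOut δ lam u = g := by
  induction hg using Submonoid.closure_induction with
  | mem g hg =>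
    obtain ⟨q, rfl⟩ := hg
    exact ⟨[q], rfl⟩
  | one => exact ⟨[], rfl⟩
  | mul g h _ _ ihg ihh =>
    obtain ⟨u, hu⟩ := ihg
    obtain ⟨u', hu'⟩ := ihh
    refine ⟨u' ++ u, funext fun w => ?_⟩
    rw [Equiv.Perm.mul_apply, ← hu, ← hu']
    simp [wOut]

theorem finite_autGroup_of_finite_range_wOut (hinv : ∀ q, Function.Bijective (lam q))
    (h : (Set.range (wOut δ lam)).Finite) :
    (autGroup δ lam : Set (Equiv.Perm (List A))).Finite := by
  have hfin : (Submonoid.closure (Set.range (tPerm δ lam hinv)) :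
      Set (Equiv.Perm (List A))).Finite := by
    refine Set.Finite.of_finite_image (f := fun g : Equiv.Perm (List A) => ⇑g) (h.subset ?_)
      DFunLike.coe_injective.injOn
    rintro _ ⟨g, hg, rfl⟩
    exact exists_wOut_of_mem_closure hinv hg
  rw [autGroup_eq_closure_range hinv, ← Subgroup.coe_toSubmonoid,
    Subgroup.closure_toSubmonoid_of_isOfFinOrder]
  · exact hfin
  · intro g hg
    rw [← finite_powers]
    exact hfin.subset (Submonoid.powers_le.2 (Submonoid.subset_closure hg))

end Transducer

end Paper

/-- for an invertible transducer, `G(𝒜)` is finite iff the dual section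
semigroup is finite iff the orbits on the boundary have uniformly bounded size. -/
theorem statement_4 {Q A : Type*} [Fintype Q] [Fintype A] [Nonempty Q] [Nonempty A]
    (δ : Q → A → Q) (lam : Q → A → A) (hinv : ∀ q, Function.Bijective (lam q)) :
    List.TFAE [
      Set.Finite (autGroup δ lam : Set (Equiv.Perm (List A))),
      Set.Finite {f : List Q → List Q | ∃ v : List A, v ≠ [] ∧ f = fun u => secW δ lam u v},
      ∃ n : ℕ, ∀ v : ℕ → A,
        Set.Finite {x : ℕ → A | ∃ g ∈ autGroup δ lam, boundaryAct (⇑g) v = x} ∧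
        Set.ncard {x : ℕ → A | ∃ g ∈ autGroup δ lam, boundaryAct (⇑g) v = x} ≤ n ] := by
  tfae_have 1 → 2 := by
    intro h
    have := h.to_subtype
    refine (finite_range_secW (δ := δ) hinv).subset ?_
    rintro _ ⟨v, -, rfl⟩
    exact ⟨v, rfl⟩
  tfae_have 2 → 1 := by
    intro h
    refine finite_autGroup_of_finite_range_wOut hinv (finite_range_wOut
      ((h.insert (fun u => secW δ lam u [])).subset ?_))
    rintro _ ⟨v, rfl⟩
    by_cases hv : v = []
    · exact Or.inl (by rw [hv])
    · exact Or.inr ⟨v, hv, rfl⟩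
  tfae_have 1 → 3 := fun h => ⟨(autGroup δ lam : Set (Equiv.Perm (List A))).ncard, fun v =>
    ⟨h.image fun g : Equiv.Perm (List A) => boundaryAct (⇑g) v, Set.ncard_image_le h⟩⟩
  tfae_have 3 → 1 := fun ⟨n, h⟩ =>
    have := finite_autGroup_of_boundary_orbits hinv n h
    Set.toFinite _
  tfae_finish
end

section
/- Let 𝒜 = (Q,Ã,δ₁,λ₁) and ℬ = (T,Ã,δ₂,λ₂) be inverse transducers over the same involutive alphabet Ã, and let p ∈ Q, q ∈ T. The following are equivalent: (i) ‖(𝒜ℬ,(p,q))‖ = ‖(𝒜,p)‖; (ii) L_O(𝒜,p) ⊆ L_I(ℬ,q); (iii) L_I(𝒜ℬ,(p,q)) = L_I(𝒜,p). -/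
open Paper


namespace Paper

/-- Iterated transition function. -/
def delStar {Q B : Type*} (δ : Q → B → Q) (q : Q) (w : List B) : Q := w.foldl δ q

/-- ℬ is an inverse transducer over the involutive alphabet `Ã = A ⊕ A`
(the involution being `Sum.swap`). -/
def InvTrans {Q A : Type*} (δ : Q → A ⊕ A → Q) (lam : Q → A ⊕ A → A ⊕ A) : Prop :=
  ∀ q x, δ (δ q x) x.swap = q ∧ lam (δ q x) x.swap = (lam q x).swap

/-- Input language: loops at `q`. -/
def LI {Q B : Type*} (δ : Q → B → Q) (q : Q) : Set (List B) := {w | delStar δ q w = q}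

/-- Output language: outputs of loops at `q`. -/
def LO {Q B : Type*} (δ : Q → B → Q) (lam : Q → B → B) (q : Q) : Set (List B) :=
  {v | ∃ w, delStar δ q w = q ∧ tOut δ lam q w = v}

/-- Connected component of a state. -/
def comp {Q B : Type*} (δ : Q → B → Q) (q : Q) : Set Q := {q' | ∃ w, delStar δ q w = q'}

end Paper

namespace Paper

section InverseTransitions

variable {S T A B : Type*}

/-- The formal inverse of a word over the involutive alphabet `A ⊕ A`. -/
def wordInv (w : List (A ⊕ A)) : List (A ⊕ A) := (w.map Sum.swap).reverse

theorem wordInv_wordInv (w : List (A ⊕ A)) : wordInv (wordInv w) = w := by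
  simp [wordInv]

theorem delStar_append (δ : S → B → S) (s : S) (u v : List B) :
    delStar δ s (u ++ v) = delStar δ (delStar δ s u) v :=
  List.foldl_append

theorem delStar_wordInv {δ : S → A ⊕ A → S} (h : ∀ s x, δ (δ s x) x.swap = s)
    (s : S) (w : List (A ⊕ A)) : delStar δ (delStar δ s w) (wordInv w) = s := by
  induction w generalizing s with
  | nil => rfl
  | cons x w ih =>
    have hw : wordInv (x :: w) = wordInv w ++ [x.swap] := by simp [wordInv]
    rw [hw, delStar_append]
    exact (congrArg (δ · x.swap) (ih (δ s x))).trans (h s x)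

theorem delStar_append_wordInv_eq_iff {δ : S → A ⊕ A → S} (h : ∀ s x, δ (δ s x) x.swap = s)
    (s : S) (u v : List (A ⊕ A)) :
    delStar δ s (u ++ wordInv v) = s ↔ delStar δ s u = delStar δ s v := by
  rw [delStar_append]
  constructor
  · intro huv
    have := delStar_wordInv h (delStar δ s u) (wordInv v)
    rwa [wordInv_wordInv, huv, eq_comm] at this
  · intro huv
    rw [huv, delStar_wordInv h]

theorem prodδ_swap {δ₁ : S → A ⊕ A → S} {lam₁ : S → A ⊕ A → A ⊕ A} {δ₂ : T → A ⊕ A → T}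
    (h₁ : InvTrans δ₁ lam₁) (h₂ : ∀ t x, δ₂ (δ₂ t x) x.swap = t) (s : S × T) (x : A ⊕ A) :
    prodδ δ₁ lam₁ δ₂ (prodδ δ₁ lam₁ δ₂ s x) x.swap = s := by
  simp [prodδ, h₁ s.1 x, h₂]

theorem delStar_prodδ (δ₁ : S → B → S) (lam₁ : S → B → B) (δ₂ : T → B → T)
    (p : S) (q : T) (w : List B) :
    delStar (prodδ δ₁ lam₁ δ₂) (p, q) w = (delStar δ₁ p w, delStar δ₂ q (tOut δ₁ lam₁ p w)) := by
  induction w generalizing p q with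
  | nil => rfl
  | cons x w ih => exact ih (δ₁ p x) (δ₂ q (lam₁ p x))

theorem image_fst_comp_prodδ (δ₁ : S → B → S) (lam₁ : S → B → B) (δ₂ : T → B → T)
    (p : S) (q : T) : Prod.fst '' comp (prodδ δ₁ lam₁ δ₂) (p, q) = comp δ₁ p := by
  ext s
  simp [comp, delStar_prodδ]

end InverseTransitions

end Paper

/-- for inverse transducers `𝒜`, `ℬ` and states `p`, `q`, the component of
`(p,q)` in the product has the size of the component of `p` iff `L_O(𝒜,p) ⊆ L_I(ℬ,q)`
iff `L_I(𝒜ℬ,(p,q)) = L_I(𝒜,p)`. -/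
theorem statement_5 {Q T A : Type*} [Fintype Q] [Fintype T] [Fintype A]
    [Nonempty Q] [Nonempty T] [Nonempty A]
    (δ₁ : Q → A ⊕ A → Q) (lam₁ : Q → A ⊕ A → A ⊕ A)
    (δ₂ : T → A ⊕ A → T) (lam₂ : T → A ⊕ A → A ⊕ A)
    (h₁ : InvTrans δ₁ lam₁) (h₂ : InvTrans δ₂ lam₂) (p : Q) (q : T) :
    List.TFAE [
      Set.ncard (comp (prodδ δ₁ lam₁ δ₂) (p, q)) = Set.ncard (comp δ₁ p),
      LO δ₁ lam₁ p ⊆ LI δ₂ q,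
      LI (prodδ δ₁ lam₁ δ₂) (p, q) = LI δ₁ p ] := by
  have hinv := prodδ_swap h₁ fun t x => (h₂ t x).1
  tfae_have 1 → 2 := by
    rintro hcard _ ⟨w, hw, rfl⟩
    rw [← image_fst_comp_prodδ δ₁ lam₁ δ₂ p q, eq_comm] at hcard
    have hinj := Set.injOn_of_ncard_image_eq hcard (Set.toFinite _)
    have hloop : delStar (prodδ δ₁ lam₁ δ₂) (p, q) w = (p, q) :=
      hinj ⟨w, rfl⟩ ⟨[], rfl⟩ (by rw [delStar_prodδ, hw])
    rw [delStar_prodδ] at hloop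
    exact congrArg Prod.snd hloop
  tfae_have 2 → 3 := by
    intro hsub
    ext w
    simp only [LI, Set.mem_ofPred_eq, delStar_prodδ, Prod.mk.injEq, and_iff_left_iff_imp]
    exact fun hw => hsub ⟨w, hw, rfl⟩
  tfae_have 3 → 1 := by
    intro hLI
    rw [← image_fst_comp_prodδ δ₁ lam₁ δ₂ p q]
    refine (Set.InjOn.ncard_image ?_).symm
    rintro _ ⟨u, rfl⟩ _ ⟨v, rfl⟩ huv
    rw [delStar_prodδ, delStar_prodδ] at huv
    have hloop : u ++ wordInv v ∈ LI δ₁ p :=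
      (delStar_append_wordInv_eq_iff (fun s x => (h₁ s x).1) p u v).2 huv
    rw [← hLI] at hloop
    exact (delStar_append_wordInv_eq_iff hinv (p, q) u v).1 hloop
  tfae_finish
end

section
/- Let 𝒜 = (Q,A,δ,λ) be a reversible transducer. Then 𝒜 is bireversible if and only if the product 𝒜𝒜 is bireversible. -/
open Paper


/-- a reversible transducer is bireversible iff its square is bireversible. -/
theorem statement_6 {Q A : Type*} [Fintype Q] [Fintype A] [Nonempty Q] [Nonempty A]
    (δ : Q → A → Q) (lam : Q → A → A) (hrev : Reversible δ) :
    Bireversible δ lam ↔ Bireversible (prodδ δ lam δ) (prodLam lam lam) := by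
  constructor
  · rintro ⟨hinv, -, hinj⟩
    refine ⟨fun p => (hinv p.2).comp (hinv p.1), fun a => ?_, ?_⟩
    · refine Finite.injective_iff_bijective.mp ?_
      rintro ⟨q, t⟩ ⟨q', t'⟩ h
      obtain ⟨h₁, h₂⟩ := Prod.ext_iff.mp h
      obtain rfl : q = q' := (hrev a).injective h₁
      obtain rfl : t = t' := (hrev (lam q a)).injective h₂
      rfl
    · rintro ⟨q, t⟩ ⟨q', t'⟩ a a' hl hd
      obtain ⟨h₁, h₂⟩ := Prod.ext_iff.mp hd
      obtain ⟨rfl, h₃⟩ := Prod.ext_iff.mp (hinj _ _ _ _ hl h₂)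
      obtain ⟨rfl, rfl⟩ := Prod.ext_iff.mp (hinj _ _ _ _ h₃ h₁)
      rfl
  · rintro ⟨hinv, -, hinj⟩
    refine ⟨fun q => Finite.injective_iff_bijective.mp ?_, hrev, fun q q' a a' hl hd => ?_⟩
    · exact Function.Injective.of_comp (f := lam q) (hinv (q, q)).injective
    · have h := hinj (q, q) (q', q) a a' (by simp only [prodLam, hl])
        (by simp only [prodδ, hl, hd])
      simp_all only [Prod.mk.injEq]
end

section
/- Let G be a finite group with more than one element and let 𝒟 be the dual Cayley machine of G. Then the maps 𝒟_x (x ∈ G) generate a free semigroup of self-maps of G*: for any nonempty words u and v over G, if 𝒟_u = 𝒟_v as maps G* → G*, then u = v. -/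
open Paper

section DualCayley

variable {G : Type*} [Group G]

/-- Output map of a word of states of the dual Cayley machine. -/
abbrev cayleyOut (u w : List G) : List G :=
  wOut (fun x g => g * x) (fun x g => g * x) u w

/-- Section of a word of states of the dual Cayley machine by a letter. -/
abbrev cayleySec (a : G) (u : List G) : List G :=
  sec (fun x g => g * x) (fun x g => g * x) u a

theorem cayleyOut_cons (u : List G) (a : G) (w : List G) :
    cayleyOut u (a :: w) = (a * u.prod) :: cayleyOut (cayleySec a u) w := by
  induction u generalizing a w with
  | nil => simp [cayleyOut, wOut, cayleySec, sec]
  | cons x u ih =>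
    have := ih (a * x) (tOut (fun x g => g * x) (fun x g => g * x) (a * x) w)
    simpa [cayleyOut, wOut, cayleySec, sec, tOut, mul_assoc] using this

theorem cayleyOut_append_singleton (u : List G) (x : G) (w : List G) :
    cayleyOut (u ++ [x]) w =
      tOut (fun x g => g * x) (fun x g => g * x) x (cayleyOut u w) := by
  simp [cayleyOut, wOut]

theorem tOut_cayley_injective (x : G) :
    Function.Injective (tOut (fun x g => g * x) (fun x g : G => g * x) x) := by
  intro w
  induction w generalizing x with
  | nil => intro w' h; cases w' <;> simp_all [tOut]
  | cons a w ih =>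
    intro w' h
    cases w' with
    | nil => simp [tOut] at h
    | cons b w' =>
      simp only [tOut, List.cons.injEq, mul_left_inj] at h
      obtain ⟨rfl, h⟩ := h
      rw [ih _ h]

theorem length_cayleySec (a : G) (u : List G) :
    (cayleySec a u).length = u.length := by
  induction u generalizing a with
  | nil => rfl
  | cons x u ih => simpa [cayleySec, sec] using ih (a * x)

theorem cayleySec_injective (a : G) : Function.Injective (cayleySec a) := by
  intro u
  induction u generalizing a with
  | nil => intro v h; cases v <;> simp_all [cayleySec, sec]
  | cons x u ih =>
    intro v h
    cases v with
    | nil => simp [cayleySec, sec] at h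
    | cons y v =>
      simp only [cayleySec, sec, List.cons.injEq, mul_right_inj] at h
      obtain ⟨rfl, h⟩ := h
      rw [ih _ h]

theorem getLast?_cayleySec (a : G) {u : List G} (hu : u ≠ []) :
    (cayleySec a u).getLast? = some (a * u.prod) := by
  induction u generalizing a with
  | nil => exact absurd rfl hu
  | cons x u ih =>
    rcases eq_or_ne u [] with rfl | h
    · simp [cayleySec, sec]
    · have := ih (a * x) h
      simp only [cayleySec] at this
      simp [cayleySec, sec, List.getLast?_cons, this, mul_assoc]

theorem mem_periodicPts_cayleySec [Finite G] (a : G) (u : List G) :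
    u ∈ Function.periodicPts (cayleySec a) := by
  let f : {l : List G // l.length = u.length} → {l : List G // l.length = u.length} :=
    fun l => ⟨cayleySec a l.1, (length_cayleySec a l.1).trans l.2⟩
  have hf : Function.Injective f := fun l m h =>
    Subtype.ext (cayleySec_injective a (congrArg Subtype.val h))
  have : Finite {l : List G // l.length = u.length} := List.finite_length_eq G u.length
  obtain ⟨n, hn, h⟩ := hf.mem_periodicPts ⟨u, rfl⟩
  exact ⟨n, hn, h.map (g := Subtype.val) fun _ => rfl⟩

theorem prod_eq_of_cayleyOut_eq {u v : List G} (h : cayleyOut u = cayleyOut v) :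
    u.prod = v.prod := by
  have h₁ := congrFun h [1]
  rw [cayleyOut_cons, cayleyOut_cons, List.cons.injEq] at h₁
  exact mul_left_cancel h₁.1

theorem cayleyOut_iterate_cayleySec {u v : List G} (h : cayleyOut u = cayleyOut v)
    (a : G) (n : ℕ) :
    cayleyOut ((cayleySec a)^[n] u) = cayleyOut ((cayleySec a)^[n] v) := by
  induction n with
  | zero => exact h
  | succ n ih =>
    funext w
    have := congrFun ih (a :: w)
    rw [cayleyOut_cons, cayleyOut_cons, List.cons.injEq] at this
    simpa only [Function.iterate_succ_apply'] using this.2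

theorem iterate_cayleySec_ne_nil {u : List G} (hu : u ≠ []) (a : G) (n : ℕ) :
    (cayleySec a)^[n] u ≠ [] := by
  induction n with
  | zero => exact hu
  | succ n ih =>
    rw [Function.iterate_succ_apply', ← List.length_pos_iff, length_cayleySec,
      List.length_pos_iff]
    exact ih

theorem getLast?_eq_of_cayleyOut_eq [Finite G] {u v : List G} (hu : u ≠ [])
    (hv : v ≠ []) (h : cayleyOut u = cayleyOut v) : u.getLast? = v.getLast? := by
  obtain ⟨m, hm, hum⟩ := mem_periodicPts_cayleySec 1 u
  obtain ⟨n, hn, hvn⟩ := mem_periodicPts_cayleySec 1 v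
  obtain ⟨k, hk⟩ := Nat.exists_eq_succ_of_ne_zero (Nat.mul_pos hm hn).ne'
  have hu' := (hum.mul_const n).eq
  have hv' := (hvn.const_mul m).eq
  rw [hk, Function.iterate_succ_apply'] at hu' hv'
  rw [← hu', ← hv', getLast?_cayleySec _ (iterate_cayleySec_ne_nil hu 1 k),
    getLast?_cayleySec _ (iterate_cayleySec_ne_nil hv 1 k),
    prod_eq_of_cayleyOut_eq (cayleyOut_iterate_cayleySec h 1 k)]

theorem eq_nil_of_cayleyOut_eq [Finite G] [Nontrivial G] {u : List G}
    (h : cayleyOut u = cayleyOut []) : u = [] := by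
  by_contra hu
  have key (a : G) : u.getLast? = some a := by
    obtain ⟨n, hn, hun⟩ := mem_periodicPts_cayleySec a u
    obtain ⟨k, rfl⟩ := Nat.exists_eq_succ_of_ne_zero hn.ne'
    have hnil : (cayleySec a)^[k] [] = [] := Function.iterate_fixed rfl k
    have hprod := prod_eq_of_cayleyOut_eq (cayleyOut_iterate_cayleySec h a k)
    have hu' := hun.eq
    rw [Function.iterate_succ_apply'] at hu'
    rw [← hu', getLast?_cayleySec _ (iterate_cayleySec_ne_nil hu a k), hprod, hnil,
      List.prod_nil, mul_one]
  obtain ⟨a, b, hab⟩ := exists_pair_ne G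
  exact hab (Option.some.inj ((key a).symm.trans (key b)))

theorem cayleyOut_injective [Finite G] [Nontrivial G] :
    Function.Injective (cayleyOut : List G → List G → List G) := by
  intro u
  induction u using List.reverseRecOn with
  | nil => exact fun v h => (eq_nil_of_cayleyOut_eq h.symm).symm
  | append_singleton u x ih =>
    intro v h
    rcases List.eq_nil_or_concat' v with rfl | ⟨v, y, rfl⟩
    · exact eq_nil_of_cayleyOut_eq h
    · have hxy : x = y := by
        simpa using getLast?_eq_of_cayleyOut_eq (by simp) (by simp) h
      subst hxy
      have huv : cayleyOut u = cayleyOut v := by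
        funext w
        apply tOut_cayley_injective x
        simpa only [cayleyOut_append_singleton] using congrFun h w
      rw [ih huv]

end DualCayley


/-- the dual Cayley machine of a non-trivial finite group generates a
free semigroup: equal induced maps on `G*` force equal (nonempty) words. -/
theorem statement_8 {G : Type*} [Group G] [Fintype G] [Nontrivial G]
    (u v : List G) (hu : u ≠ []) (hv : v ≠ [])
    (h : ∀ w : List G,
      wOut (fun x g => g * x) (fun x g => g * x) u w =
      wOut (fun x g => g * x) (fun x g => g * x) v w) :
    u = v := by
  exact cayleyOut_injective (funext h)
end

section
/- Let G be a finite group with more than one element and let 𝒟 be the dual Cayley machine of G. Then no nonempty positive word is a relation of the group generated by 𝒟: for every nonempty word u over G, the map 𝒟_u : G* → G* is not the identity. -/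
open Paper


section DualCayley

variable {G : Type*} [Group G]

theorem wOut_mul_cons (u : List G) (g : G) (w : List G) :
    wOut (fun x g => g * x) (fun x g => g * x) u (g :: w) =
      (g * u.prod) :: wOut (fun x g => g * x) (fun x g => g * x)
        (sec (fun x g => g * x) (fun x g => g * x) u g) w := by
  induction u generalizing g w with
  | nil => simp [wOut, sec]
  | cons x u ih =>
    simpa [wOut, sec, tOut, mul_assoc] using ih (g * x) (tOut _ _ (g * x) w)

theorem sec_mul_append (s t : List G) (g : G) :
    sec (fun x g => g * x) (fun x g => g * x) (s ++ t) g =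
      sec (fun x g => g * x) (fun x g => g * x) s g ++
        sec (fun x g => g * x) (fun x g => g * x) t (g * s.prod) := by
  induction s generalizing g with
  | nil => simp [sec]
  | cons x s ih => simp [sec, ih, mul_assoc]

theorem length_sec_mul (u : List G) (g : G) :
    (sec (fun x g => g * x) (fun x g => g * x) u g).length = u.length := by
  induction u generalizing g with
  | nil => rfl
  | cons x u ih => simp [sec, ih]

theorem exists_sec_mul_eq (z : List G) (g : G) :
    ∃ y : List G, y.length = z.length ∧
      sec (fun x g => g * x) (fun x g => g * x) y g = z := by
  induction z generalizing g with
  | nil => exact ⟨[], rfl, rfl⟩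
  | cons a z ih =>
    obtain ⟨y, hy, rfl⟩ := ih a
    exact ⟨(g⁻¹ * a) :: y, by simp [hy], by simp [sec]⟩

/-- If some word acts as the identity, then every short enough word is a suffix of a word of the
same length acting as the identity. -/
theorem exists_wOut_eq_self_suffix (u : List G)
    (hu : ∀ w, wOut (fun x g => g * x) (fun x g => g * x) u w = w)
    (z : List G) (hz : z.length ≤ u.length) :
    ∃ v : List G, v.length = u.length ∧ z <:+ v ∧
      ∀ w, wOut (fun x g => g * x) (fun x g => g * x) v w = w := by
  obtain ⟨m, hm⟩ : ∃ m, z.length = m := ⟨_, rfl⟩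
  induction m generalizing z with
  | zero => exact ⟨u, rfl, by simp [List.length_eq_zero_iff.mp hm], hu⟩
  | succ m ih =>
    obtain ⟨a, z, rfl⟩ := List.exists_cons_of_length_eq_add_one hm
    obtain ⟨y, hy, rfl⟩ := exists_sec_mul_eq z a
    simp only [List.length_cons] at hm hz
    obtain ⟨v, hv, ⟨s, rfl⟩, hid⟩ := ih y (by omega) (by omega)
    have key : ∀ w, _ := fun w => hid ((a * y.prod) :: w)
    simp only [wOut_mul_cons, List.cons.injEq, mul_eq_left] at key
    have hprod : s.prod = y.prod⁻¹ := by
      simpa [mul_eq_one_iff_eq_inv] using (key []).1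
    refine ⟨_, (length_sec_mul _ _).trans hv, ?_, fun w => (key w).2⟩
    rcases List.eq_nil_or_concat s with rfl | ⟨s, c, rfl⟩
    · simp at hv
      omega
    · rw [sec_mul_append, hprod, mul_inv_cancel_right, List.concat_eq_append, sec_mul_append]
      have hc : a * y.prod * s.prod * c = a := by
        simp only [List.concat_eq_append, List.prod_append, List.prod_singleton] at hprod
        rw [mul_assoc _ s.prod, hprod, mul_inv_cancel_right]
      exact ⟨sec (fun x g => g * x) (fun x g => g * x) s (a * y.prod), by simp [sec, hc]⟩

end DualCayley

/-- no nonempty positive word over the dual Cayley machine of a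
non-trivial finite group acts as the identity on `G*`. -/
theorem statement_9 {G : Type*} [Group G] [Fintype G] [Nontrivial G]
    (u : List G) (hu : u ≠ []) :
    ¬ ∀ w : List G, wOut (fun x g => g * x) (fun x g => g * x) u w = w := by
  intro hid
  obtain ⟨a, ha⟩ := exists_ne (1 : G)
  have hpos := List.length_pos_iff.mpr hu
  obtain ⟨v, hv, hsuf, hvid⟩ := exists_wOut_eq_self_suffix u hid
    (a :: List.replicate (u.length - 1) 1) (by simp; omega)
  obtain rfl := hsuf.eq_of_length (by simp; omega)
  have h := hvid [1]
  rw [wOut_mul_cons] at h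
  simp [ha] at h
end

section
/- Let G be a finite group with identity e and let 𝒟 be the dual Cayley machine of G; each 𝒟_x is a bijection of G*. If k ≥ 1 and u₁, u₂, …, u_{2k} ∈ G satisfy u₁u₂⋯u_{2k} = e, then the permutation (𝒟_{u_{2k}^{-1}})^{-1} ∘ 𝒟_{u_{2k-1}} ∘ ⋯ ∘ (𝒟_{u₄^{-1}})^{-1} ∘ 𝒟_{u₃} ∘ (𝒟_{u₂^{-1}})^{-1} ∘ 𝒟_{u₁} of G* (in which 𝒟_{u₁} is applied first, then the inverse of 𝒟_{u₂⁻¹}, then 𝒟_{u₃}, and so on, alternating) is the identity map of G*. In particular the alternating image of every even-length relation of G is a relation of the automaton group generated by the 𝒟_x. -/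
open Paper


namespace Paper

/-- The alternating composition `⋯ ∘ (𝒟_{u₄⁻¹})⁻¹ ∘ 𝒟_{u₃} ∘ (𝒟_{u₂⁻¹})⁻¹ ∘ 𝒟_{u₁}`
for the dual Cayley machine (the map of smallest index is applied first). -/
noncomputable def altComp {G : Type*} [Group G] (u : ℕ → G) : ℕ → (List G → List G)
  | 0 => id
  | j + 1 =>
      (if j % 2 = 0 then tOut (fun x g => g * x) (fun x g => g * x) (u j)
       else Function.invFun (tOut (fun x g => g * x) (fun x g => g * x) ((u j)⁻¹)))
        ∘ altComp u j

end Paper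

namespace Paper

/-- Multiplying the initial state on the right multiplies every output letter on the right. -/
theorem tOut_dualCayley_mul {G : Type*} [Group G] (x y : G) (w : List G) :
    tOut (fun x g : G => g * x) (fun x g : G => g * x) (x * y) w =
      (tOut (fun x g : G => g * x) (fun x g : G => g * x) x w).map (· * y) := by
  induction w generalizing x with
  | nil => rfl
  | cons a w ih => simp only [tOut, List.map_cons, ← mul_assoc, ih]

theorem tOut_dualCayley_eq_map {G : Type*} [Group G] (x : G) (w : List G) :
    tOut (fun x g : G => g * x) (fun x g : G => g * x) x w =
      (tOut (fun x g : G => g * x) (fun x g : G => g * x) 1 w).map (· * x) := by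
  simpa using tOut_dualCayley_mul 1 x w

theorem tOut_dualCayley_injective {G : Type*} [Group G] (x : G) :
    Function.Injective (tOut (fun x g : G => g * x) (fun x g : G => g * x) x) := by
  intro v w
  induction v generalizing x w with
  | nil => cases w <;> simp [tOut]
  | cons a v ih =>
    cases w with
    | nil => simp [tOut]
    | cons b w =>
      simp only [tOut, List.cons.injEq, mul_left_inj, and_imp]
      rintro rfl hvw
      exact ⟨rfl, ih _ hvw⟩

theorem tOut_dualCayley_surjective {G : Type*} [Group G] (x : G) :
    Function.Surjective (tOut (fun x g : G => g * x) (fun x g : G => g * x) x) := by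
  intro v
  induction v generalizing x with
  | nil => exact ⟨[], rfl⟩
  | cons b v ih =>
    obtain ⟨w, hw⟩ := ih b
    exact ⟨b * x⁻¹ :: w, by simp [tOut, hw]⟩

/-- `𝒟₁` conjugates the alternating composition of even length to right multiplication of all
letters by the product of the word. -/
theorem tOut_one_altComp {G : Type*} [Group G] (u : ℕ → G) (k : ℕ) (w : List G) :
    tOut (fun x g : G => g * x) (fun x g : G => g * x) 1 (altComp u (2 * k) w) =
      (tOut (fun x g : G => g * x) (fun x g : G => g * x) 1 w).map
        (· * ((List.range (2 * k)).map u).prod) := by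
  induction k with
  | zero => simp [altComp]
  | succ k ih =>
    have hinv := Function.rightInverse_invFun
      (tOut_dualCayley_surjective (u (2 * k + 1))⁻¹)
      (tOut (fun x g : G => g * x) (fun x g : G => g * x) (u (2 * k)) (altComp u (2 * k) w))
    have hmul : 2 * (k + 1) = 2 * k + 1 + 1 := by ring
    have hodd : (2 * k + 1) % 2 ≠ 0 := by lia
    have heven : 2 * k % 2 = 0 := by lia
    rw [hmul]
    simp only [altComp, if_neg hodd, if_pos heven, Function.comp_apply]
    rw [← inv_mul_cancel (u (2 * k + 1)), tOut_dualCayley_mul, hinv,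
      tOut_dualCayley_eq_map, inv_mul_cancel, ih]
    simp [List.range_succ, Function.comp_def, mul_assoc]

end Paper

/-- the alternating image of an even-length relation of `G` is a relation
of the group generated by the dual Cayley machine. -/
theorem statement_10 {G : Type*} [Group G] [Fintype G]
    (k : ℕ) (hk : 1 ≤ k) (u : ℕ → G)
    (h : ((List.range (2 * k)).map u).prod = 1) :
    altComp u (2 * k) = id := by
  funext w
  apply tOut_dualCayley_injective 1
  rw [tOut_one_altComp, h]
  simp
end

section
/- Let G be a finite group and let 𝒟 be the dual of the palindrome Cayley machine of G, with K = G(𝒟) the group generated by the bijections 𝒟_x (x ∈ G), and π : FreeGroup(G) → K the homomorphism sending the free generator indexed by x to 𝒟_x. Let H be the kernel of the evaluation homomorphism FreeGroup(G) → G and φ the automorphism of FreeGroup(G) sending each free generator to its inverse. Then: (a) the kernel of π equals H ∩ φ(H), so K is isomorphic to the palindromic group FreeGroup(G)/(H ∩ φ(H)); (b) for every g ∈ G, the stabilizer in K of the length-one word g ∈ G* is isomorphic to H/(H ∩ φ(H)); (c) for every word w ∈ G* of length at least 2, the stabilizer of w in K is trivial. -/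
open Paper


namespace FreeGroup

variable {G : Type*}

theorem lift_inv_of_involutive (u : FreeGroup G) :
    FreeGroup.lift (fun x : G => (FreeGroup.of x)⁻¹)
      (FreeGroup.lift (fun x : G => (FreeGroup.of x)⁻¹) u) = u := by
  have h : (FreeGroup.lift fun x : G => (FreeGroup.of x)⁻¹).comp
      (FreeGroup.lift fun x : G => (FreeGroup.of x)⁻¹) = MonoidHom.id _ := by
    ext x
    simp
  exact DFunLike.congr_fun h u

variable [Group G]

theorem lift_id_lift_inv_of (u : FreeGroup G) :
    FreeGroup.lift (id : G → G) (FreeGroup.lift (fun x : G => (FreeGroup.of x)⁻¹) u) =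
      FreeGroup.lift (fun x : G => x⁻¹) u := by
  have h : (FreeGroup.lift (id : G → G)).comp
      (FreeGroup.lift fun x : G => (FreeGroup.of x)⁻¹) = FreeGroup.lift fun x : G => x⁻¹ := by
    ext x
    simp
  exact DFunLike.congr_fun h u

theorem lift_inv_lift_inv_of (u : FreeGroup G) :
    FreeGroup.lift (fun x : G => x⁻¹) (FreeGroup.lift (fun x : G => (FreeGroup.of x)⁻¹) u) =
      FreeGroup.lift (id : G → G) u := by
  rw [← lift_id_lift_inv_of, lift_inv_of_involutive]

theorem mem_map_lift_inv_of_ker_lift_id {u : FreeGroup G} :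
    u ∈ Subgroup.map (FreeGroup.lift fun x : G => (FreeGroup.of x)⁻¹)
      (MonoidHom.ker (FreeGroup.lift (id : G → G))) ↔
      FreeGroup.lift (fun x : G => x⁻¹) u = 1 := by
  constructor
  · rintro ⟨v, hv, rfl⟩
    rw [lift_inv_lift_inv_of]
    exact hv
  · intro hu
    exact ⟨_, (lift_id_lift_inv_of u).trans hu, lift_inv_of_involutive u⟩

theorem lift_id_map_inv (u : FreeGroup G) :
    FreeGroup.lift (id : G → G) (FreeGroup.map (fun x : G => x⁻¹) u) =
      FreeGroup.lift (fun x : G => x⁻¹) u := by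
  have h : (FreeGroup.lift (id : G → G)).comp (FreeGroup.map fun x : G => x⁻¹) =
      FreeGroup.lift fun x : G => x⁻¹ := by
    ext x
    simp
  exact DFunLike.congr_fun h u

theorem lift_inv_map_inv (u : FreeGroup G) :
    FreeGroup.lift (fun x : G => x⁻¹) (FreeGroup.map (fun x : G => x⁻¹) u) =
      FreeGroup.lift (id : G → G) u := by
  have h : (FreeGroup.lift fun x : G => x⁻¹).comp (FreeGroup.map fun x : G => x⁻¹) =
      FreeGroup.lift (id : G → G) := by
    ext x
    simp
  exact DFunLike.congr_fun h u

end FreeGroup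

section PalindromeDual

variable {G : Type*} [Group G] {π : FreeGroup G →* Equiv.Perm (List G)}

theorem palindromeDual_nil
    (hπ : ∀ x : G, ∀ w : List G,
      π (FreeGroup.of x) w = tOut (fun (y : G) (_ : G) => y⁻¹) (fun y g => g * y) x w)
    (u : FreeGroup G) : π u [] = [] := by
  induction u using FreeGroup.induction_on with
  | C1 => simp
  | of x => simp [hπ, tOut]
  | inv_of x ih => rw [map_inv, Equiv.Perm.inv_eq_iff_eq, ih]
  | mul u v hu hv => rw [map_mul, Equiv.Perm.mul_apply, hv, hu]

theorem palindromeDual_cons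
    (hπ : ∀ x : G, ∀ w : List G,
      π (FreeGroup.of x) w = tOut (fun (y : G) (_ : G) => y⁻¹) (fun y g => g * y) x w)
    (u : FreeGroup G) (g : G) (w : List G) :
    π u (g :: w) =
      (g * (FreeGroup.lift (fun x : G => x⁻¹) u)⁻¹) ::
        π (FreeGroup.map (fun x : G => x⁻¹) u) w := by
  induction u using FreeGroup.induction_on generalizing g w with
  | C1 => simp
  | of x => simp [hπ, tOut]
  | inv_of x ih =>
    rw [map_inv, Equiv.Perm.inv_eq_iff_eq, ih]
    simp
  | mul u v hu hv =>
    rw [map_mul, Equiv.Perm.mul_apply, hv, hu]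
    simp [mul_assoc]

theorem palindromeDual_eq_one
    (hπ : ∀ x : G, ∀ w : List G,
      π (FreeGroup.of x) w = tOut (fun (y : G) (_ : G) => y⁻¹) (fun y g => g * y) x w)
    {u : FreeGroup G} (hu : FreeGroup.lift (id : G → G) u = 1)
    (hu' : FreeGroup.lift (fun x : G => x⁻¹) u = 1) : π u = 1 := by
  ext1 w
  induction w generalizing u with
  | nil => exact palindromeDual_nil hπ u
  | cons g w ih =>
    rw [palindromeDual_cons hπ, hu',
      ih ((FreeGroup.lift_id_map_inv u).trans hu') ((FreeGroup.lift_inv_map_inv u).trans hu)]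
    simp

theorem palindromeDual_apply_singleton_eq_iff
    (hπ : ∀ x : G, ∀ w : List G,
      π (FreeGroup.of x) w = tOut (fun (y : G) (_ : G) => y⁻¹) (fun y g => g * y) x w)
    (u : FreeGroup G) (g : G) :
    π u [g] = [g] ↔ FreeGroup.lift (fun x : G => x⁻¹) u = 1 := by
  rw [palindromeDual_cons hπ, palindromeDual_nil hπ]
  simp

theorem palindromeDual_eq_one_of_apply_eq
    (hπ : ∀ x : G, ∀ w : List G,
      π (FreeGroup.of x) w = tOut (fun (y : G) (_ : G) => y⁻¹) (fun y g => g * y) x w)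
    {u : FreeGroup G} {w : List G} (hw : 2 ≤ w.length) (h : π u w = w) :
    FreeGroup.lift (id : G → G) u = 1 ∧ FreeGroup.lift (fun x : G => x⁻¹) u = 1 := by
  match w, hw with
  | g :: g' :: w, _ =>
    rw [palindromeDual_cons hπ, palindromeDual_cons hπ, FreeGroup.lift_inv_map_inv] at h
    simp only [List.cons.injEq, mul_eq_left, inv_eq_one] at h
    exact ⟨h.2.1, h.1⟩

theorem ker_palindromeDual
    (hπ : ∀ x : G, ∀ w : List G,
      π (FreeGroup.of x) w = tOut (fun (y : G) (_ : G) => y⁻¹) (fun y g => g * y) x w) :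
    MonoidHom.ker π =
      MonoidHom.ker (FreeGroup.lift (id : G → G)) ⊓
        Subgroup.map (FreeGroup.lift fun x : G => (FreeGroup.of x)⁻¹)
          (MonoidHom.ker (FreeGroup.lift (id : G → G))) := by
  ext u
  rw [Subgroup.mem_inf, FreeGroup.mem_map_lift_inv_of_ker_lift_id, MonoidHom.mem_ker,
    MonoidHom.mem_ker]
  constructor
  · intro h
    exact palindromeDual_eq_one_of_apply_eq hπ (w := [1, 1]) le_rfl (by simp [h])
  · rintro ⟨h, h'⟩
    exact palindromeDual_eq_one hπ h h'

end PalindromeDual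

/-- for the dual `𝒟` of the palindrome Cayley machine of a finite group
`G` (transition `δ x g = x⁻¹`, output `λ x g = g·x`), with `π : FreeGroup G →* Perm G*`
sending the generator `x` to `𝒟ₓ`, `H` the kernel of the evaluation map and `φ` the
automorphism inverting each generator: (a) `ker π = H ⊓ φ(H)` (so `K = π.range` is the
palindromic group), (b) the stabilizer in `K` of a length-one word is isomorphic to
`H/(H ⊓ φ(H))`, and (c) stabilizers of words of length `≥ 2` are trivial. -/
theorem statement_11 {G : Type*} [Group G] [Fintype G]
    (π : FreeGroup G →* Equiv.Perm (List G))
    (hπ : ∀ x : G, ∀ w : List G,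
      π (FreeGroup.of x) w = tOut (fun (y : G) (_ : G) => y⁻¹) (fun y g => g * y) x w) :
    (MonoidHom.ker π =
        MonoidHom.ker (FreeGroup.lift (id : G → G)) ⊓
          Subgroup.map (FreeGroup.lift fun x : G => (FreeGroup.of x)⁻¹)
            (MonoidHom.ker (FreeGroup.lift (id : G → G)))) ∧
    (∀ g : G, ∃ f : ↥(MonoidHom.ker (FreeGroup.lift (id : G → G))) →*
        ↥(MonoidHom.range π ⊓ MulAction.stabilizer (Equiv.Perm (List G)) ([g] : List G)),
      Function.Surjective f ∧
      MonoidHom.ker f =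
        (MonoidHom.ker (FreeGroup.lift (id : G → G)) ⊓
          Subgroup.map (FreeGroup.lift fun x : G => (FreeGroup.of x)⁻¹)
            (MonoidHom.ker (FreeGroup.lift (id : G → G)))).subgroupOf
          (MonoidHom.ker (FreeGroup.lift (id : G → G)))) ∧
    (∀ w : List G, 2 ≤ w.length → ∀ kk ∈ MonoidHom.range π, kk w = w → kk = 1) := by
  refine ⟨ker_palindromeDual hπ, fun g => ?_, ?_⟩
  · refine ⟨((π.comp (FreeGroup.lift fun x : G => (FreeGroup.of x)⁻¹)).comp
      (Subgroup.subtype _)).codRestrict _ ?_, ?_, ?_⟩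
    · rintro ⟨u, hu⟩
      refine ⟨⟨_, rfl⟩, ?_⟩
      exact (palindromeDual_apply_singleton_eq_iff hπ _ g).2
        ((FreeGroup.lift_inv_lift_inv_of u).trans hu)
    · rintro ⟨_, ⟨u, rfl⟩, hu⟩
      refine ⟨⟨_, (FreeGroup.lift_id_lift_inv_of u).trans
        ((palindromeDual_apply_singleton_eq_iff hπ u g).1 hu)⟩, Subtype.ext ?_⟩
      exact congrArg π (FreeGroup.lift_inv_of_involutive u)
    · ext ⟨u, hu⟩
      rw [Subgroup.mem_subgroupOf, Subgroup.mem_inf, MonoidHom.mem_ker, Subtype.ext_iff]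
      change π (FreeGroup.lift (fun x : G => (FreeGroup.of x)⁻¹) u) = 1 ↔ _
      rw [← MonoidHom.mem_ker, ker_palindromeDual hπ, Subgroup.mem_inf,
        FreeGroup.mem_map_lift_inv_of_ker_lift_id, FreeGroup.mem_map_lift_inv_of_ker_lift_id,
        FreeGroup.lift_inv_lift_inv_of, MonoidHom.mem_ker, FreeGroup.lift_id_lift_inv_of,
        MonoidHom.mem_ker]
      exact and_comm
  · rintro w hw _ ⟨u, rfl⟩ h
    obtain ⟨h₁, h₂⟩ := palindromeDual_eq_one_of_apply_eq hπ hw h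
    exact palindromeDual_eq_one hπ h₁ h₂
end

section
/- Let 𝒜 = (Q,A,δ,λ) be an invertible transducer such that the group G(𝒜) is infinite. Let u ∈ A^+ be a nonempty word and suppose that u induces a torsion element of the semigroup generated by the section maps on Q̃*: there exist k, p ≥ 1 such that w⟨u^{k+p}⟩ = w⟨u^k⟩ for every w ∈ Q̃*. Then the stabilizer St(u^ω) of the periodic boundary point u^ω ∈ A^ω in G(𝒜) is nontrivial. -/
open Paper


namespace Paper

variable {Q A : Type*}

theorem rep_add (u : List A) (m n : ℕ) : rep u (m + n) = rep u m ++ rep u n := by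
  rw [rep, List.replicate_add, List.flatten_append, rep, rep]

theorem rep_rep (u : List A) (p n : ℕ) : rep (rep u p) n = rep u (p * n) := by
  induction n with
  | zero => simp [rep]
  | succ n ih => rw [rep_add, ih, Nat.mul_succ, rep_add]; simp [rep]

variable [Nonempty A]

theorem map_perSeq_range (u : List A) (n : ℕ) :
    (List.range (n * u.length)).map (perSeq u) = rep u n := by
  induction n with
  | zero => simp [rep]
  | succ n ih =>
    rw [Nat.succ_mul, List.range_add, List.map_append, ih, rep_add]
    congr 1
    apply List.ext_getElem
    · simp [rep]
    · intro i h₁ h₂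
      have hi : i < u.length := by simpa using h₁
      simp [rep, perSeq, Nat.mod_eq_of_lt hi, hi]

theorem length_tOutT (δ : Q → A → Q) (lam : Q → A → A) (x : Q ⊕ Q) (v : List A) :
    (tOutT δ lam x v).length = v.length := by
  induction v generalizing x with
  | nil => rfl
  | cons a v ih => simp [tOutT, ih]

theorem length_wOutT (δ : Q → A → Q) (lam : Q → A → A) (w : List (Q ⊕ Q)) (v : List A) :
    (wOutT δ lam w v).length = v.length := by
  induction w generalizing v with
  | nil => rfl
  | cons x w ih => exact (ih _).trans (length_tOutT δ lam x v)

theorem wOutT_nil (δ : Q → A → Q) (lam : Q → A → A) (w : List (Q ⊕ Q)) :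
    wOutT δ lam w [] = [] :=
  List.length_eq_zero_iff.1 (length_wOutT δ lam w [])

theorem wOutT_cons (δ : Q → A → Q) (lam : Q → A → A) (w : List (Q ⊕ Q)) (a : A) (v : List A) :
    wOutT δ lam w (a :: v) = wOutT δ lam w [a] ++ wOutT δ lam (secT δ lam w a) v := by
  induction w generalizing a v with
  | nil => rfl
  | cons x w ih => exact ih _ _

theorem wOutT_append (δ : Q → A → Q) (lam : Q → A → A) (w : List (Q ⊕ Q)) (x v : List A) :
    wOutT δ lam w (x ++ v) = wOutT δ lam w x ++ wOutT δ lam (secTW δ lam w x) v := by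
  induction x generalizing w with
  | nil => simp [wOutT_nil, secTW]
  | cons a x ih =>
    rw [List.cons_append, wOutT_cons, ih, wOutT_cons δ lam w a x, List.append_assoc]
    rfl

theorem tOutT_inl (δ : Q → A → Q) (lam : Q → A → A) (q : Q) (v : List A) :
    tOutT δ lam (Sum.inl q) v = tOut δ lam q v := by
  induction v generalizing q with
  | nil => rfl
  | cons a v ih => simp [tOutT, tOut, stepT, ih]

theorem tOut_tOutT_inr (δ : Q → A → Q) (lam : Q → A → A)
    (hinv : ∀ q, Function.Bijective (lam q)) (q : Q) (v : List A) :
    tOut δ lam q (tOutT δ lam (Sum.inr q) v) = v := by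
  induction v generalizing q with
  | nil => rfl
  | cons a v ih =>
    simp [tOutT, tOut, stepT, ih, Function.rightInverse_invFun (hinv q).surjective a]

theorem exists_wOutT_of_mem_autGroup (δ : Q → A → Q) (lam : Q → A → A)
    (hinv : ∀ q, Function.Bijective (lam q)) {g : Equiv.Perm (List A)}
    (hg : g ∈ autGroup δ lam) : ∃ w : List (Q ⊕ Q), ∀ v, g v = wOutT δ lam w v := by
  induction hg using Subgroup.closure_induction_right with
  | one => exact ⟨[], fun v => rfl⟩
  | mul_right g _ s hs ih =>
    obtain ⟨w, hw⟩ := ih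
    obtain ⟨q, hq⟩ := hs
    refine ⟨Sum.inl q :: w, fun v => ?_⟩
    rw [Equiv.Perm.mul_apply, hw, hq, ← tOutT_inl]
    rfl
  | mul_inv_cancel g _ s hs ih =>
    obtain ⟨w, hw⟩ := ih
    obtain ⟨q, hq⟩ := hs
    refine ⟨Sum.inr q :: w, fun v => ?_⟩
    have hs : s⁻¹ v = tOutT δ lam (Sum.inr q) v := by
      rw [Equiv.Perm.inv_eq_iff_eq, hq, tOut_tOutT_inr δ lam hinv]
    rw [Equiv.Perm.mul_apply, hw, hs]
    rfl

/-- If the section at `x` is again fixed by the section at `y` and `x ++ y` is fixed, then all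
words `x y^n` are fixed. -/
theorem wOutT_append_rep (δ : Q → A → Q) (lam : Q → A → A) (w : List (Q ⊕ Q)) (x y : List A)
    (hsec : secTW δ lam w (x ++ y) = secTW δ lam w x)
    (hfix : wOutT δ lam w (x ++ y) = x ++ y) (n : ℕ) :
    wOutT δ lam w (x ++ rep y n) = x ++ rep y n := by
  rw [wOutT_append] at hfix ⊢
  obtain ⟨hx, hy⟩ := List.append_inj hfix (length_wOutT δ lam w x)
  have hsec' : secTW δ lam (secTW δ lam w x) y = secTW δ lam w x := by
    simpa [secTW, List.foldl_append] using hsec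
  rw [hx]
  congr 1
  induction n with
  | zero => exact wOutT_nil δ lam _
  | succ n ih =>
    have h1 : rep y 1 = y := by simp [rep]
    rw [add_comm, rep_add, h1, wOutT_append, hy, hsec', ih]

theorem exists_ne_apply_eq [Finite A] (δ : Q → A → Q) (lam : Q → A → A)
    (hinv : ∀ q, Function.Bijective (lam q))
    (hG : Set.Infinite (autGroup δ lam : Set (Equiv.Perm (List A)))) (x : List A) :
    ∃ g ∈ autGroup δ lam, ∃ h ∈ autGroup δ lam, g ≠ h ∧ g x = h x := by
  have hmaps : Set.MapsTo (fun g : Equiv.Perm (List A) => g x) (autGroup δ lam)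
      {v : List A | v.length = x.length} := by
    intro g hg
    obtain ⟨w, hw⟩ := exists_wOutT_of_mem_autGroup δ lam hinv hg
    simp [hw, length_wOutT]
  obtain ⟨g, hg, h, hh, hne, heq⟩ :=
    hG.exists_ne_map_eq_of_mapsTo hmaps (List.finite_length_eq A x.length)
  exact ⟨g, hg, h, hh, hne, heq⟩

end Paper

/-- if `G(𝒜)` is infinite and the nonempty word `u` is a torsion element of
the semigroup of the enriched dual, then the stabilizer of `u^ω` is nontrivial. -/
theorem statement_15 {Q A : Type*} [Fintype Q] [Fintype A] [Nonempty Q] [Nonempty A]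
    (δ : Q → A → Q) (lam : Q → A → A) (hinv : ∀ q, Function.Bijective (lam q))
    (hG : Set.Infinite (autGroup δ lam : Set (Equiv.Perm (List A))))
    (u : List A) (hu : u ≠ []) (k p : ℕ) (hk : 1 ≤ k) (hp : 1 ≤ p)
    (htor : ∀ w : List (Q ⊕ Q), secTW δ lam w (rep u (k + p)) = secTW δ lam w (rep u k)) :
    ∃ g ∈ autGroup δ lam, g ≠ 1 ∧ boundaryAct (⇑g) (perSeq u) = perSeq u := by
  obtain ⟨g, hg, h, hh, hne, heq⟩ := exists_ne_apply_eq δ lam hinv hG (rep u (k + p))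
  have hf : h⁻¹ * g ∈ autGroup δ lam := mul_mem (inv_mem hh) hg
  refine ⟨h⁻¹ * g, hf, fun h1 => hne (inv_mul_eq_one.1 h1).symm, ?_⟩
  have hfix : (h⁻¹ * g) (rep u (k + p)) = rep u (k + p) := by
    rw [Equiv.Perm.mul_apply, heq, ← Equiv.Perm.mul_apply, inv_mul_cancel, Equiv.Perm.one_apply]
  obtain ⟨w, hw⟩ := exists_wOutT_of_mem_autGroup δ lam hinv hf
  have hper (n : ℕ) : wOutT δ lam w (rep u (k + p * n)) = rep u (k + p * n) := by
    have := wOutT_append_rep δ lam w (rep u k) (rep u p)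
      (by rw [← rep_add]; exact htor w) (by rw [← rep_add, ← hw]; exact hfix) n
    rwa [rep_rep, ← rep_add] at this
  funext i
  have hle : i + 1 ≤ (k + p * (i + 1)) * u.length := by
    have hu' : 1 ≤ u.length := List.length_pos_iff.2 hu
    nlinarith [Nat.mul_le_mul hp (le_refl (i + 1))]
  obtain ⟨m, hm⟩ := Nat.exists_eq_add_of_le hle
  have hpre := hper (i + 1)
  rw [← map_perSeq_range, hm, List.range_add, List.map_append, wOutT_append] at hpre
  have hprefix := (List.append_inj hpre (length_wOutT δ lam w _)).1
  simp only [boundaryAct, hw, hprefix]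
  simp
end

section
/- Let 𝒜 = (Q,A,δ,λ) be an invertible transducer and G = G(𝒜). Suppose there exist k ≥ 1 and words p₁, p₂ ∈ A^k such that p₂ lies in the orbit G·p₁ and for every g ∈ St(p₁) the section g|_{p₁} fixes p₂, i.e. g|_{p₁}(p₂) = p₂. Then there exists a nonempty word w ∈ A^+ such that the orbit G·(w^ω) of the periodic boundary point w^ω is finite (i.e., w^ω has a finite Schreier graph). -/
open Paper

namespace Paper

section TransducerGroup

variable {Q A : Type*} {δ : Q → A → Q} {lam : Q → A → A}

theorem exists_tOut_append (q : Q) (u : List A) :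
    ∃ q', ∀ v, tOut δ lam q (u ++ v) = tOut δ lam q u ++ tOut δ lam q' v := by
  induction u generalizing q with
  | nil => exact ⟨q, fun v => rfl⟩
  | cons a u ih =>
    obtain ⟨q', h⟩ := ih (δ q a)
    exact ⟨q', fun v => by simp [tOut, h]⟩

theorem length_of_mem_autGroup {g : Equiv.Perm (List A)} (hg : g ∈ autGroup δ lam)
    (u : List A) : (g u).length = u.length := by
  induction hg using Subgroup.closure_induction generalizing u with
  | mem g h =>
    obtain ⟨q, hq⟩ := h
    rw [hq, length_tOut]
  | one => rfl
  | mul g h _ _ ihg ihh => rw [Equiv.Perm.mul_apply, ihg, ihh]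
  | inv g _ ih => rw [← ih (g⁻¹ u), show g (g⁻¹ u) = u from g.apply_symm_apply u]

theorem exists_section_of_mem_autGroup (hinv : ∀ q, Function.Bijective (lam q))
    {g : Equiv.Perm (List A)} (hg : g ∈ autGroup δ lam) (u : List A) :
    ∃ s ∈ autGroup δ lam, ∀ v, g (u ++ v) = g u ++ s v := by
  induction hg using Subgroup.closure_induction generalizing u with
  | mem g h =>
    obtain ⟨q, hq⟩ := h
    obtain ⟨q', hq'⟩ := exists_tOut_append (δ := δ) (lam := lam) q u
    refine ⟨Equiv.ofBijective _ (tOut_bijective (δ := δ) hinv q'),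
      Subgroup.subset_closure ⟨q', fun w => rfl⟩, fun v => ?_⟩
    rw [hq, hq, hq']
    rfl
  | one => exact ⟨1, one_mem _, fun v => rfl⟩
  | mul g h _ _ ihg ihh =>
    obtain ⟨s, hs, hsv⟩ := ihh u
    obtain ⟨t, ht, htv⟩ := ihg (h u)
    exact ⟨t * s, mul_mem ht hs, fun v => by simp [hsv, htv]⟩
  | inv g _ ih =>
    obtain ⟨s, hs, hsv⟩ := ih (g⁻¹ u)
    refine ⟨s⁻¹, inv_mem hs, fun v => g.injective ?_⟩
    have hg : ∀ x, g (g⁻¹ x) = x := g.apply_symm_apply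
    have hss : s (s⁻¹ v) = v := s.apply_symm_apply v
    rw [hsv, hg, hg, hss]

theorem map_take_of_mem_autGroup (hinv : ∀ q, Function.Bijective (lam q))
    {g : Equiv.Perm (List A)} (hg : g ∈ autGroup δ lam) (m : ℕ) (w : List A) :
    g (w.take m) = (g w).take m := by
  rcases le_total m w.length with hm | hm
  · obtain ⟨s, -, hs⟩ := exists_section_of_mem_autGroup hinv hg (w.take m)
    have h := hs (w.drop m)
    rw [List.take_append_drop] at h
    rw [h, List.take_left' (by rw [length_of_mem_autGroup hg, List.length_take_of_le hm])]
  · rw [List.take_of_length_le hm, List.take_of_length_le (by rwa [length_of_mem_autGroup hg])]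

end TransducerGroup

section IteratedWords

variable {A : Type*}

/-- The concatenation `u f(u) ⋯ fⁿ⁻¹(u)`. -/
def iterWord (f : List A → List A) : ℕ → List A → List A
  | 0, _ => []
  | n + 1, u => u ++ iterWord f n (f u)

theorem iterWord_add (f : List A → List A) (m n : ℕ) (u : List A) :
    iterWord f (m + n) u = iterWord f m u ++ iterWord f n (f^[m] u) := by
  induction m generalizing u with
  | zero => simp [iterWord]
  | succ m ih => simp [Nat.succ_add, iterWord, ih]

theorem length_iterWord {f : List A → List A} {k : ℕ}
    (hf : ∀ u : List A, u.length = k → (f u).length = k) (n : ℕ) {u : List A}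
    (hu : u.length = k) : (iterWord f n u).length = n * k := by
  induction n generalizing u with
  | zero => simp [iterWord]
  | succ n ih => simp [iterWord, ih (hf u hu), hu, Nat.succ_mul, add_comm]

/-- The infinite sequence `u f(u) f²(u) ⋯`. -/
noncomputable def iterSeq [Nonempty A] (f : List A → List A) (u : List A) : ℕ → A :=
  fun i => (iterWord f (i + 1) u).getD i (Classical.arbitrary A)

variable [Nonempty A] {f : List A → List A} {k : ℕ}

theorem getElem?_iterWord (hk : 1 ≤ k) (hf : ∀ u : List A, u.length = k → (f u).length = k)
    {n i : ℕ} {u : List A} (hu : u.length = k) (hi : i < n * k) :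
    (iterWord f n u)[i]? = some (iterSeq f u i) := by
  have hlen : i < (iterWord f (i + 1) u).length := by
    rw [length_iterWord hf _ hu]
    nlinarith
  have hseq : (iterWord f (i + 1) u)[i]? = some (iterSeq f u i) := by
    simp [iterSeq, List.getElem?_eq_getElem hlen]
  rw [← hseq]
  rcases le_total n (i + 1) with h | h
  · obtain ⟨m, hm⟩ := Nat.exists_eq_add_of_le h
    rw [hm, iterWord_add, List.getElem?_append_left (by rwa [length_iterWord hf _ hu])]
  · obtain ⟨m, rfl⟩ := Nat.exists_eq_add_of_le h
    rw [iterWord_add, List.getElem?_append_left hlen]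

theorem map_range_iterSeq (hk : 1 ≤ k) (hf : ∀ u : List A, u.length = k → (f u).length = k)
    {u : List A} (hu : u.length = k) (m : ℕ) :
    (List.range m).map (iterSeq f u) = (iterWord f m u).take m := by
  apply List.ext_getElem?
  intro i
  by_cases hi : i < m
  · rw [List.getElem?_take_of_lt hi, getElem?_iterWord hk hf hu (by nlinarith)]
    simp [hi]
  · rw [List.getElem?_eq_none (by simpa using hi),
      List.getElem?_eq_none (by simp; omega)]

theorem iterSeq_add (hk : 1 ≤ k) (hf : ∀ u : List A, u.length = k → (f u).length = k)
    {u : List A} (hu : u.length = k) (n i : ℕ) (hn : (f^[n] u).length = k) :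
    iterSeq f u (n * k + i) = iterSeq f (f^[n] u) i := by
  have h₁ := getElem?_iterWord hk hf (n := n + (i + 1)) (i := n * k + i) hu (by nlinarith)
  rw [iterWord_add, List.getElem?_append_right (by rw [length_iterWord hf _ hu]; omega),
    length_iterWord hf _ hu, Nat.add_sub_cancel_left,
    getElem?_iterWord hk hf hn (by nlinarith)] at h₁
  exact (Option.some.inj h₁).symm

theorem perSeq_iterWord (hk : 1 ≤ k) (hf : ∀ u : List A, u.length = k → (f u).length = k)
    {u : List A} (hu : u.length = k) {n : ℕ} (hn : 0 < n) (hper : f^[n] u = u) :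
    perSeq (iterWord f n u) = iterSeq f u := by
  have hp : Function.Periodic (iterSeq f u) (n * k) := fun i => by
    rw [add_comm, iterSeq_add hk hf hu n i (by rw [hper, hu]), hper]
  funext i
  rw [← hp.map_mod_nat i]
  have hlt : i % (n * k) < n * k := Nat.mod_lt _ (by positivity)
  rw [perSeq, length_iterWord hf _ hu, List.getD_eq_getElem?_getD,
    getElem?_iterWord hk hf hu hlt, Option.getD_some]

end IteratedWords

section EquivariantMap

variable {Q A : Type*} {δ : Q → A → Q} {lam : Q → A → A}

/-- If the sections at `p₁` of its stabilizer fix `p₂`, then `h p₁ ↦ h|_{p₁} p₂` is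
well defined on the orbit of `p₁`. -/
theorem exists_extension_map {k : ℕ} {p₁ p₂ : List A} (h₂ : p₂.length = k)
    (hinv : ∀ q, Function.Bijective (lam q))
    (hsec : ∀ g ∈ autGroup δ lam, g p₁ = p₁ → g (p₁ ++ p₂) = p₁ ++ p₂) :
    ∃ f : List A → List A, (∀ u, u.length = k → (f u).length = k) ∧
      ∀ h ∈ autGroup δ lam, h (p₁ ++ p₂) = h p₁ ++ f (h p₁) := by
  have hex : ∀ u : List A, ∃ v : List A, (u.length = k → v.length = k) ∧
      ∀ h ∈ autGroup δ lam, h p₁ = u → h (p₁ ++ p₂) = u ++ v := by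
    intro u
    by_cases hu : ∃ g ∈ autGroup δ lam, g p₁ = u
    · obtain ⟨g, hg, rfl⟩ := hu
      obtain ⟨s, hs, hsv⟩ := exists_section_of_mem_autGroup hinv hg p₁
      refine ⟨s p₂, fun _ => by rw [length_of_mem_autGroup hs, h₂], fun h hh hu => ?_⟩
      have hfix := hsec (g⁻¹ * h) (mul_mem (inv_mem hg) hh) (by simp [hu])
      rw [← hsv]
      exact Equiv.Perm.inv_eq_iff_eq.mp hfix
    · exact ⟨u, id, fun h hh h' => absurd ⟨h, hh, h'⟩ hu⟩
  choose f hf hfe using hex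
  exact ⟨f, hf, fun h hh => hfe _ h hh rfl⟩

variable {k : ℕ} {O : Set (List A)} {f : List A → List A}

theorem map_iterWord_of_mem_autGroup (hinv : ∀ q, Function.Bijective (lam q))
    (hfO : Set.MapsTo f O O)
    (hfe : ∀ g ∈ autGroup δ lam, ∀ u ∈ O, g (u ++ f u) = g u ++ f (g u))
    {g : Equiv.Perm (List A)} (hg : g ∈ autGroup δ lam) (n : ℕ) {u : List A} (hu : u ∈ O) :
    g (iterWord f n u) = iterWord f n (g u) := by
  induction n generalizing g u with
  | zero => exact List.length_eq_zero_iff.mp (by rw [length_of_mem_autGroup hg]; rfl)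
  | succ n ih =>
    obtain ⟨s, hs, hsv⟩ := exists_section_of_mem_autGroup hinv hg u
    have hsf : s (f u) = f (g u) := by
      rw [← List.append_cancel_left_eq (g u), ← hsv, hfe g hg u hu]
    rw [iterWord, hsv, ih hs (hfO hu), hsf, iterWord]

theorem boundaryAct_iterSeq [Nonempty A] (hk : 1 ≤ k)
    (hinv : ∀ q, Function.Bijective (lam q))
    (hf : ∀ u : List A, u.length = k → (f u).length = k)
    (hlen : ∀ u ∈ O, u.length = k) (hfO : Set.MapsTo f O O)
    (hfe : ∀ g ∈ autGroup δ lam, ∀ u ∈ O, g (u ++ f u) = g u ++ f (g u))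
    {g : Equiv.Perm (List A)} (hg : g ∈ autGroup δ lam) {u : List A} (hu : u ∈ O) :
    boundaryAct g (iterSeq f u) = iterSeq f (g u) := by
  funext i
  have hgu : (g u).length = k := by rw [length_of_mem_autGroup hg, hlen u hu]
  rw [boundaryAct, map_range_iterSeq hk hf (hlen u hu), map_take_of_mem_autGroup hinv hg,
    map_iterWord_of_mem_autGroup hinv hfO hfe hg _ hu, List.getD_eq_getElem?_getD,
    List.getElem?_take_of_lt (Nat.lt_succ_self i),
    getElem?_iterWord hk hf hgu (by nlinarith), Option.getD_some]

end EquivariantMap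

/-- A self-map preserving a finite set has a periodic point in the forward orbit of any of
its elements. -/
theorem exists_periodic_of_mapsTo {α : Type*} {f : α → α} {s : Set α} (hs : s.Finite)
    (hf : Set.MapsTo f s s) {x : α} (hx : x ∈ s) : ∃ u ∈ s, ∃ n, 0 < n ∧ f^[n] u = u := by
  obtain ⟨i, j, hij, h⟩ := hs.exists_lt_map_eq_of_forall_mem (f := fun n : ℕ => f^[n] x)
    (fun n => hf.iterate n hx)
  refine ⟨f^[i] x, hf.iterate i hx, j - i, Nat.sub_pos_of_lt hij, ?_⟩
  rw [← Function.iterate_add_apply, Nat.sub_add_cancel hij.le]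
  exact h.symm

end Paper

/-- if some word `p₁` of length `k` has a word `p₂` in its orbit such that
the section at `p₁` of every stabilizing element fixes `p₂`, then some periodic boundary
point has a finite orbit (finite Schreier graph). -/
theorem statement_17 {Q A : Type*} [Fintype Q] [Fintype A] [Nonempty Q] [Nonempty A]
    (δ : Q → A → Q) (lam : Q → A → A) (hinv : ∀ q, Function.Bijective (lam q))
    (k : ℕ) (hk : 1 ≤ k) (p₁ p₂ : List A) (h₁ : p₁.length = k) (h₂ : p₂.length = k)
    (horb : ∃ g ∈ autGroup δ lam, g p₁ = p₂)
    (hsec : ∀ g ∈ autGroup δ lam, g p₁ = p₁ → g (p₁ ++ p₂) = p₁ ++ p₂) :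
    ∃ w : List A, w ≠ [] ∧
      Set.Finite {x : ℕ → A | ∃ g ∈ autGroup δ lam, boundaryAct (⇑g) (perSeq w) = x} := by
  obtain ⟨f, hf, hfp⟩ := exists_extension_map h₂ hinv hsec
  obtain ⟨g₀, hg₀, rfl⟩ := horb
  let O : Set (List A) := {u | ∃ g ∈ autGroup δ lam, g p₁ = u}
  have hlen : ∀ u ∈ O, u.length = k := by
    rintro _ ⟨g, hg, rfl⟩
    rw [length_of_mem_autGroup hg, h₁]
  have hfin : {u : List A | u.length = k}.Finite := List.finite_length_eq A k
  have hfO : Set.MapsTo f O O := by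
    rintro _ ⟨g, hg, rfl⟩
    obtain ⟨s, hs, hsv⟩ := exists_section_of_mem_autGroup hinv hg p₁
    refine ⟨s * g₀, mul_mem hs hg₀, ?_⟩
    rw [Equiv.Perm.mul_apply, ← List.append_cancel_left_eq (g p₁), ← hsv, hfp g hg]
  have hfe : ∀ g ∈ autGroup δ lam, ∀ u ∈ O, g (u ++ f u) = g u ++ f (g u) := by
    rintro g hg _ ⟨h, hh, rfl⟩
    rw [← hfp h hh]
    exact hfp (g * h) (mul_mem hg hh)
  obtain ⟨u, hu, n, hn, hper⟩ :=
    exists_periodic_of_mapsTo (hfin.subset hlen) hfO ⟨1, one_mem _, rfl⟩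
  refine ⟨iterWord f n u, ?_, (hfin.image (iterSeq f)).subset ?_⟩
  · rw [← List.length_pos_iff, length_iterWord hf n (hlen u hu)]
    positivity
  · rintro _ ⟨g, hg, rfl⟩
    rw [perSeq_iterWord hk hf (hlen u hu) hn hper]
    refine ⟨g u, ?_, (boundaryAct_iterSeq hk hinv hf hlen hfO hfe hg hu).symm⟩
    rw [Set.mem_ofPred_eq, length_of_mem_autGroup hg, hlen u hu]
end
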